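/- Let α be a nonempty type and let X be the space of bounded real-valued functions on α, equipped with the supremum distance dist(u,v) = sup_{a ∈ α} |u(a) − v(a)| and the pointwise partial order. Let D ⊆ X be a nonempty closed subset, and let P : X → X be a map that is monotone (u ≤ v implies P(u) ≤ P(v)), maps D into D, and is a contraction on D, i.e. there is k ∈ [0,1) with dist(P(u),P(v)) ≤ k·dist(u,v) for all u, v ∈ D. If V ∈ X satisfies P(V) = V and there exist g₁, g₂ ∈ D with g₁ ≤ V ≤ g₂ pointwise, then V ∈ D, and V is the unique fixed point of P in D. -/

import Mathlib

open Filter Topology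

/-- In the pointwise order, a function between `u` and `w` is no farther from `u` than `w` is. -/
theorem BoundedContinuousFunction.dist_le_dist_of_le_of_le {α : Type*} [TopologicalSpace α]
    {u v w : BoundedContinuousFunction α ℝ} (huv : u ≤ v) (hvw : v ≤ w) :
    dist u v ≤ dist u w := by
  refine (BoundedContinuousFunction.dist_le dist_nonneg).2 fun a => ?_
  refine le_trans ?_ (BoundedContinuousFunction.dist_coe_le_dist a)
  have h₁ : u a ≤ v a := huv a
  have h₂ : v a ≤ w a := hvw a
  rw [Real.dist_eq, Real.dist_eq, abs_sub_comm, abs_sub_comm (u a), abs_of_nonneg (by linarith),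
    abs_of_nonneg (by linarith)]
  linarith

/-- Iterates of a map contracting on an invariant set approach each other geometrically. -/
theorem dist_iterate_le_of_contracting_on {X : Type*} [PseudoMetricSpace X] {D : Set X}
    {P : X → X} (hmaps : Set.MapsTo P D D) {k : ℝ} (hk0 : 0 ≤ k)
    (hcontr : ∀ u ∈ D, ∀ v ∈ D, dist (P u) (P v) ≤ k * dist u v)
    {x y : X} (hx : x ∈ D) (hy : y ∈ D) (n : ℕ) :
    dist (P^[n] x) (P^[n] y) ≤ k ^ n * dist x y := by
  induction n with
  | zero => simp
  | succ n ih =>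
    rw [Function.iterate_succ_apply', Function.iterate_succ_apply', pow_succ', mul_assoc]
    exact (hcontr _ (hmaps.iterate n hx) _ (hmaps.iterate n hy)).trans
      (mul_le_mul_of_nonneg_left ih hk0)

/-- Let `X` be the space of bounded (real-valued) functions on a nonempty type `α`
(realized as bounded continuous functions for the discrete topology, i.e. exactly the
bounded functions), with the supremum distance and the pointwise order. If `D ⊆ X` is
nonempty and closed, `P : X → X` is monotone, maps `D` into `D`, and is a `k`-contraction
on `D` with `k ∈ [0,1)`, and `V` is a fixed point of `P` sandwiched between two elements
of `D`, then `V ∈ D` and `V` is the unique fixed point of `P` in `D`. -/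
theorem fixed_point_in_D {α : Type*} [Nonempty α] [TopologicalSpace α] [DiscreteTopology α]
    (D : Set (BoundedContinuousFunction α ℝ)) (hDne : D.Nonempty) (hDclosed : IsClosed D)
    (P : BoundedContinuousFunction α ℝ → BoundedContinuousFunction α ℝ)
    (hmono : ∀ u v : BoundedContinuousFunction α ℝ, u ≤ v → P u ≤ P v)
    (hmaps : ∀ u ∈ D, P u ∈ D)
    (k : ℝ) (hk0 : 0 ≤ k) (hk1 : k < 1)
    (hcontr : ∀ u ∈ D, ∀ v ∈ D, dist (P u) (P v) ≤ k * dist u v)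
    (V : BoundedContinuousFunction α ℝ) (hV : P V = V)
    (g₁ g₂ : BoundedContinuousFunction α ℝ) (hg₁ : g₁ ∈ D) (hg₂ : g₂ ∈ D)
    (h₁ : g₁ ≤ V) (h₂ : V ≤ g₂) :
    V ∈ D ∧ ∀ W ∈ D, P W = W → W = V := by
  have hmono' : Monotone P := fun u v => hmono u v
  have hmaps' : Set.MapsTo P D D := hmaps
  have hVn : ∀ n, P^[n] V = V := Function.iterate_fixed hV
  have hbound : ∀ n, dist (P^[n] g₁) V ≤ k ^ n * dist g₁ g₂ := fun n =>
    (BoundedContinuousFunction.dist_le_dist_of_le_of_le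
      ((hmono'.iterate n h₁).trans_eq (hVn n)) ((hVn n).symm.trans_le (hmono'.iterate n h₂))).trans
      (dist_iterate_le_of_contracting_on hmaps' hk0 hcontr hg₁ hg₂ n)
  have hlim : Tendsto (fun n => P^[n] g₁) atTop (𝓝 V) := by
    rw [tendsto_iff_dist_tendsto_zero]
    refine squeeze_zero (fun _ => dist_nonneg) hbound ?_
    simpa using (tendsto_pow_atTop_nhds_zero_of_lt_one hk0 hk1).mul_const (dist g₁ g₂)
  have hVD : V ∈ D :=
    hDclosed.mem_of_tendsto hlim (Eventually.of_forall fun n => hmaps'.iterate n hg₁)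
  refine ⟨hVD, fun W hW hPW => dist_le_zero.1 ?_⟩
  have h := hcontr W hW V hVD
  rw [hPW, hV] at h
  nlinarith [dist_nonneg (x := W) (y := V)]
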